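/- Let Φ = {φ_j}_{j=1}^N be a self-similar system on ℝ^m satisfying the open set condition, with attractor F and scaling vector r, and set D := D_r. If the additive subgroup of ℝ generated by {log r_1,…,log r_N} is dense in ℝ, then there exists a constant C > 0 such that N_B(F,x)/x^D → C as x → ∞. -/

import Mathlib

open Filter Topology Metric

/-- The box-counting function `N_B(A,x)`: the maximal number of pairwise disjoint closed
balls of radius `x⁻¹` whose centers lie in `A`. -/
noncomputable def boxCount {m : ℕ} (A : Set (EuclideanSpace ℝ (Fin m))) (x : ℝ) : ℕ :=
  sSup {n : ℕ | ∃ c : Fin n → EuclideanSpace ℝ (Fin m), (∀ i, c i ∈ A) ∧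
    Pairwise fun i j => Disjoint (closedBall (c i) x⁻¹) (closedBall (c j) x⁻¹)}

/-- `φ` is a contracting similarity with scaling ratio `ρ`. -/
def IsSimilarity {X : Type*} [MetricSpace X] (φ : X → X) (ρ : ℝ) : Prop :=
  ∀ x y, dist (φ x) (φ y) = ρ * dist x y

section Renewal

/-- A minimum principle: a function that dominates its average over the delays `d` keeps any
lower bound it has on an initial window. -/
theorem le_of_window {ι : Type*} [Fintype ι] {p d : ι → ℝ} (hp : ∀ j, 0 < p j)
    (hp1 : ∑ j, p j = 1) {σ S : ℝ}
    (hσ : 0 < σ) (hd : ∀ j, d j ∈ Set.Icc σ S) {g : ℝ → ℝ} {T m : ℝ}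
    (hg : ∀ t, T < t → ∑ j, p j * g (t - d j) ≤ g t)
    (hw : ∀ t ∈ Set.Icc (T - S) T, m ≤ g t) {t : ℝ} (ht : T - S ≤ t) : m ≤ g t := by
  have key : ∀ n : ℕ, ∀ t, T - S ≤ t → t ≤ T + n * σ → m ≤ g t := by
    intro n
    induction n with
    | zero => exact fun t h1 h2 => hw t ⟨h1, by simpa using h2⟩
    | succ n ih =>
      intro t h1 h2
      rcases le_or_gt t T with h | h
      · exact hw t ⟨h1, h⟩
      · refine le_trans ?_ (hg t h)
        calc m = ∑ j, p j * m := by rw [← Finset.sum_mul, hp1, one_mul]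
          _ ≤ _ := by
            refine Finset.sum_le_sum fun j _ => mul_le_mul_of_nonneg_left ?_ (hp j).le
            refine ih _ (by linarith [(hd j).2]) ?_
            push_cast at h2
            linarith [(hd j).1]
  obtain ⟨n, hn⟩ := exists_nat_ge ((t - T) / σ)
  refine key n t ht ?_
  rw [div_le_iff₀ hσ] at hn
  linarith

/-- The additive monoid generated by delays generating a dense group is eventually dense. -/
theorem exists_window_of_dense {ι : Type*} {d : ι → ℝ}
    (hdense : Dense (AddSubgroup.closure (Set.range d) : Set ℝ)) {ε W : ℝ} (hε : 0 < ε) :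
    ∃ (L : Finset ℝ) (B : ℝ), (∀ x ∈ L, x ∈ AddSubmonoid.closure (Set.range d)) ∧
      ∀ y ∈ Set.Icc B (B + W), ∃ x ∈ L, x ∈ Set.Icc y (y + ε) := by
  have hdiff : ∀ g ∈ AddSubgroup.closure (Set.range d), ∃ a ∈ AddSubmonoid.closure (Set.range d),
      ∃ b ∈ AddSubmonoid.closure (Set.range d), g = a - b := by
    intro g hg
    induction hg using AddSubgroup.closure_induction with
    | mem x hx => exact ⟨x, AddSubmonoid.subset_closure hx, 0, zero_mem _, by simp⟩
    | zero => exact ⟨0, zero_mem _, 0, zero_mem _, by simp⟩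
    | add x y _ _ hx hy =>
      obtain ⟨a, ha, b, hb, rfl⟩ := hx
      obtain ⟨a', ha', b', hb', rfl⟩ := hy
      exact ⟨a + a', add_mem ha ha', b + b', add_mem hb hb', by ring⟩
    | neg x _ hx =>
      obtain ⟨a, ha, b, hb, rfl⟩ := hx
      exact ⟨b, hb, a, ha, by ring⟩
  obtain ⟨g, hg, hg0, hgε⟩ := hdense.exists_between hε
  obtain ⟨a, ha, b, hb, rfl⟩ := hdiff g hg
  set g := a - b with hgdef
  obtain ⟨n, hn⟩ := exists_nat_ge (W / g + 1)
  refine ⟨(Finset.range (n + 1)).image fun i : ℕ => i • a + (n - i) • b, n * b, ?_, ?_⟩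
  · intro x hx
    obtain ⟨i, -, rfl⟩ := Finset.mem_image.1 hx
    exact add_mem (nsmul_mem ha _) (nsmul_mem hb _)
  · intro y hy
    have hq : (y - n * b) / g ≤ W / g := by gcongr; linarith [hy.2]
    have hq0 : 0 ≤ (y - n * b) / g := div_nonneg (by linarith [hy.1]) hg0.le
    have hlt := Nat.ceil_lt_add_one hq0
    have hle := Nat.le_ceil ((y - n * b) / g)
    set i := ⌈(y - n * b) / g⌉₊
    have hin : i ≤ n := by
      have : (i : ℝ) < n + 1 := by linarith
      exact_mod_cast Nat.lt_succ_iff.1 (by exact_mod_cast this)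
    refine ⟨_, Finset.mem_image.2 ⟨i, Finset.mem_range.2 (by omega), rfl⟩, ?_⟩
    have hx : i • a + (n - i) • b = n * b + i * g := by
      simp only [nsmul_eq_mul, Nat.cast_sub hin, hgdef]
      ring
    rw [hx]
    have e : (y - n * b) / g * g = y - n * b := div_mul_cancel₀ _ hg0.ne'
    constructor
    · nlinarith
    · nlinarith

/-- A one-sided renewal theorem for a nonlattice system of delays: a nonnegative function of
controlled decrease which is dominated by its delayed averages, and dominates them up to an
exponentially small error, converges. -/
theorem exists_tendsto_of_renewal {ι : Type*} [Fintype ι] [Nonempty ι] {p d : ι → ℝ}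
    (hp : ∀ j, 0 < p j)
    (hp1 : ∑ j, p j = 1) (hd : ∀ j, 0 < d j)
    (hdense : Dense (AddSubgroup.closure (Set.range d) : Set ℝ)) {u : ℝ → ℝ} {D δ K t₀ : ℝ}
    (hD : 0 ≤ D) (hδ : 0 < δ) (hK : 0 ≤ K) (hu0 : ∀ t, 0 ≤ u t)
    (hmono : ∀ t h, 0 ≤ h → Real.exp (-D * h) * u t ≤ u (t + h))
    (hsub : ∀ t, u t ≤ ∑ j, p j * u (t - d j))
    (hsup : ∀ t, t₀ ≤ t → ∑ j, p j * u (t - d j) - K * Real.exp (-δ * t) ≤ u t) :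
    ∃ M, Tendsto u atTop (𝓝 M) := by
  obtain ⟨jmin, hjmin⟩ := Finite.exists_min d
  obtain ⟨jmax, hjmax⟩ := Finite.exists_max d
  set σ := d jmin
  set S := d jmax
  have hσ : 0 < σ := hd jmin
  have hS : 0 < S := hd jmax
  have hdI : ∀ j, d j ∈ Set.Icc σ S := fun j => ⟨hjmin j, hjmax j⟩
  -- boundedness from above
  obtain ⟨Q, hQ⟩ : ∃ Q, ∀ t, -S ≤ t → u t ≤ Q := by
    refine ⟨Real.exp (D * S) * u 0, fun t ht => ?_⟩
    have := le_of_window hp hp1 hσ hdI (g := fun t => - u t) (T := 0)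
      (m := -(Real.exp (D * S) * u 0)) (fun t _ => ?_) (fun t ht => ?_) (t := t) (by linarith)
    · simpa using this
    · simpa using hsub t
    · have h1 := hmono t (-t) (by linarith [ht.2])
      rw [add_neg_cancel] at h1
      have h2 : u t ≤ Real.exp (-D * t) * u 0 := by
        calc u t = Real.exp (-D * t) * (Real.exp (-D * -t) * u t) := by
              rw [← mul_assoc, ← Real.exp_add]; simp
          _ ≤ _ := by gcongr
      have h3 : Real.exp (-D * t) ≤ Real.exp (D * S) := by
        apply Real.exp_le_exp.2
        nlinarith [ht.1]
      simp only [neg_le_neg_iff]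
      exact h2.trans (mul_le_mul_of_nonneg_right h3 (hu0 0))
  have hbdd : IsBoundedUnder (· ≤ ·) atTop u :=
    ⟨Q, eventually_map.2 ((eventually_ge_atTop (-S)).mono hQ)⟩
  have hcobdd : IsCoboundedUnder (· ≤ ·) atTop u :=
    IsBoundedUnder.isCoboundedUnder_le ⟨0, eventually_map.2 (Eventually.of_forall hu0)⟩
  set M := limsup u atTop
  have hup : ∀ η, 0 < η → ∀ᶠ t in atTop, u t < M + η := fun η hη =>
    eventually_lt_of_limsup_lt (by linarith) hbdd
  have hfreq : ∀ η, 0 < η → ∃ᶠ t in atTop, M - η < u t := fun η hη =>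
    frequently_lt_of_lt_limsup hcobdd (by linarith)
  have hM0 : 0 ≤ M := by
    by_contra! h
    obtain ⟨t, ht⟩ := (hup (-M) (by linarith)).exists
    linarith [hu0 t]
  -- times going to infinity along which `u` is close to its upper limit
  set 𝓕 : Filter ℝ := comap u (𝓝 M) ⊓ atTop with h𝓕
  have hne : 𝓕.NeBot := by
    refine inf_neBot_iff.2 fun {s} hs {t} ht => ?_
    obtain ⟨V, hV, hVs⟩ := mem_comap.1 hs
    obtain ⟨η, hη, hηV⟩ := Metric.mem_nhds_iff.1 hV
    obtain ⟨x, ⟨hx1, hx2⟩, hx3⟩ :=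
      (((hfreq η hη).and_eventually (hup η hη)).and_eventually ht).exists
    refine ⟨x, hVs (hηV ?_), hx3⟩
    rw [Metric.mem_ball, Real.dist_eq, abs_lt]
    constructor <;> linarith
  have hu𝓕 : Tendsto u 𝓕 (𝓝 M) := tendsto_comap.mono_left inf_le_left
  have h𝓕top : 𝓕 ≤ atTop := inf_le_right
  have hgen : ∀ j, Tendsto (fun t => t - d j) 𝓕 𝓕 := by
    intro j
    have htop : Tendsto (fun t => t - d j) 𝓕 atTop :=
      (tendsto_atTop_add_const_right atTop (-d j) tendsto_id).mono_left h𝓕top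
    have hshift : ∀ η, 0 < η → ∀ i, ∀ᶠ t in 𝓕, u (t - d i) < M + η := fun η hη i =>
      ((tendsto_atTop_add_const_right atTop (-d i) tendsto_id).mono_left h𝓕top).eventually
        (hup η hη)
    refine tendsto_inf.2 ⟨tendsto_comap_iff.2 ?_, htop⟩
    rw [Metric.tendsto_nhds]
    intro η hη
    have hη' : 0 < p j * η / 2 := by have := hp j; positivity
    filter_upwards [eventually_all.2 (hshift (p j * η / 2) hη'),
      hshift η hη j, hu𝓕.eventually (lt_mem_nhds (show M - p j * η / 2 < M by linarith))]
      with t h1 h2 h3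
    rw [Function.comp_apply, Real.dist_eq, abs_lt]
    refine ⟨?_, by linarith⟩
    have h4 : ∑ i, p i * (M + p j * η / 2 - u (t - d i)) ≤ p j * η := by
      have : ∑ i, p i * (M + p j * η / 2 - u (t - d i))
          = (M + p j * η / 2) - ∑ i, p i * u (t - d i) := by
        simp only [mul_sub, Finset.sum_sub_distrib, ← Finset.sum_mul, hp1, one_mul]
      rw [this]
      linarith [hsub t]
    have h5 : p j * (M + p j * η / 2 - u (t - d j)) ≤ p j * η :=
      (Finset.single_le_sum (f := fun i => p i * (M + p j * η / 2 - u (t - d i)))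
        (fun i _ => mul_nonneg (hp i).le (by linarith [h1 i])) (Finset.mem_univ j)).trans h4
    have h6 := le_of_mul_le_mul_left h5 (hp j)
    linarith
  have hshift : ∀ x ∈ AddSubmonoid.closure (Set.range d), Tendsto (fun t => t - x) 𝓕 𝓕 := by
    intro x hx
    induction hx using AddSubmonoid.closure_induction with
    | mem x hx => obtain ⟨j, rfl⟩ := hx; exact hgen j
    | zero =>
      simp only [sub_zero]
      exact tendsto_id
    | add x y _ _ hx hy =>
      convert hy.comp hx using 2 with t
      simp; ring
  -- the supersolution obtained by absorbing the error
  obtain ⟨K', hK', hsuper⟩ : ∃ K', 0 ≤ K' ∧ ∀ t, t₀ ≤ t →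
      ∑ j, p j * (u (t - d j) - K' * Real.exp (-δ * (t - d j))) ≤
        u t - K' * Real.exp (-δ * t) := by
    set E := ∑ j, p j * Real.exp (δ * d j) with hE
    have hE1 : 1 < E := by
      rw [← hp1, hE]
      refine Finset.sum_lt_sum_of_nonempty Finset.univ_nonempty fun j _ => ?_
      have : 1 < Real.exp (δ * d j) := Real.one_lt_exp_iff.2 (mul_pos hδ (hd j))
      nlinarith [hp j]
    refine ⟨K / (E - 1), div_nonneg hK (by linarith), fun t ht => ?_⟩
    have h1 : ∑ j, p j * (u (t - d j) - K / (E - 1) * Real.exp (-δ * (t - d j)))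
        = ∑ j, p j * u (t - d j) - K / (E - 1) * Real.exp (-δ * t) * E := by
      rw [hE, Finset.mul_sum, ← Finset.sum_sub_distrib]
      refine Finset.sum_congr rfl fun j _ => ?_
      rw [show -δ * (t - d j) = -δ * t + δ * d j by ring, Real.exp_add]
      ring
    have h2 : K / (E - 1) * Real.exp (-δ * t) * E
        = K / (E - 1) * Real.exp (-δ * t) + K * Real.exp (-δ * t) := by
      have : E - 1 ≠ 0 := by linarith
      field_simp
      ring
    rw [h1, h2]
    linarith [hsup t ht]
  -- propagation of lower bounds
  have hlow : ∀ η, 0 < η → ∀ᶠ t in atTop, M - η < u t := by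
    intro η hη
    obtain ⟨ε, hε, hεM⟩ : ∃ ε, 0 < ε ∧ M - η / 3 < Real.exp (-D * ε) * M := by
      have : Tendsto (fun ε => Real.exp (-D * ε) * M) (𝓝[>] 0) (𝓝 M) := by
        have hc : Continuous fun ε => Real.exp (-D * ε) * M := by fun_prop
        simpa using (hc.tendsto 0).mono_left nhdsWithin_le_nhds
      obtain ⟨ε, h1, h2⟩ := ((this.eventually (lt_mem_nhds (show M - η / 3 < M by linarith))).and
        self_mem_nhdsWithin).exists
      exact ⟨ε, h2, h1⟩
    obtain ⟨L, B, hL, hLB⟩ := exists_window_of_dense hdense (W := S) hε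
    have herr : Tendsto (fun t => K' * Real.exp (-δ * (t - B - S))) atTop (𝓝 0) := by
      have h1 : Tendsto (fun t : ℝ => -δ * (t - B - S)) atTop atBot := by
        refine Tendsto.const_mul_atTop_of_neg (by linarith) ?_
        have : (fun t : ℝ => t - B - S) = fun t => t + (-B - S) := by ext; ring
        rw [this]
        exact tendsto_atTop_add_const_right _ _ tendsto_id
      simpa using (Real.tendsto_exp_atBot.comp h1).const_mul K'
    have hall : ∀ᶠ t in 𝓕, ∀ x ∈ L, M - η / 3 < u (t - x) :=
      (Finset.eventually_all L).2 fun x hx => (hu𝓕.comp (hshift x (hL x hx))).eventually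
        (lt_mem_nhds (by linarith))
    obtain ⟨t, ht1, ht2, ht3⟩ := (hall.and (((herr.eventually
      (gt_mem_nhds (show (0 : ℝ) < η / 3 by linarith))).and
        (eventually_ge_atTop (t₀ + B))).filter_mono h𝓕top)).exists
    filter_upwards [eventually_ge_atTop (t - B - S)] with τ hτ
    have := le_of_window hp hp1 hσ hdI (g := fun t => u t - K' * Real.exp (-δ * t)) (T := t - B)
      (m := M - η + (η / 3 - K' * Real.exp (-δ * (t - B - S))))
      (fun τ hτ => hsuper τ (by linarith)) (fun τ hτ => ?_) hτ
    · have h0 : 0 ≤ K' * Real.exp (-δ * τ) := by positivity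
      linarith
    · obtain ⟨x, hx, hx1, hx2⟩ := hLB (t - τ) ⟨by linarith [hτ.2], by linarith [hτ.1]⟩
      have h1 := hmono (t - x) (τ - (t - x)) (by linarith)
      rw [add_sub_cancel] at h1
      have h2 : Real.exp (-D * ε) * u (t - x) ≤ u τ := by
        refine le_trans (mul_le_mul_of_nonneg_right (Real.exp_le_exp.2 ?_) (hu0 _)) h1
        nlinarith
      have h3 : Real.exp (-D * ε) * (M - η / 3) ≤ Real.exp (-D * ε) * u (t - x) := by
        gcongr
        exact (ht1 x hx).le
      have h4 : Real.exp (-D * ε) ≤ 1 := Real.exp_le_one_iff.2 (by nlinarith)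
      have h5 : K' * Real.exp (-δ * τ) ≤ K' * Real.exp (-δ * (t - B - S)) := by
        gcongr ?_ * Real.exp ?_
        nlinarith [hτ.1]
      nlinarith
  refine ⟨M, Metric.tendsto_nhds.2 fun η hη => ?_⟩
  filter_upwards [hup η hη, hlow η hη] with t h1 h2
  rw [Real.dist_eq, abs_lt]
  constructor <;> linarith

end Renewal

section Packing

variable {X : Type*} [MetricSpace X]

theorem IsSimilarity.injective {f : X → X} {ρ : ℝ} (hf : IsSimilarity f ρ) (hρ : 0 < ρ) :
    Function.Injective f := fun x y h => by
  have := hf x y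
  rw [h, dist_self, eq_comm, mul_eq_zero] at this
  exact dist_eq_zero.1 (this.resolve_left hρ.ne')

/-- The maximal cardinality of a finite subset of `A` whose points are at mutual distance
greater than `s`. -/
noncomputable def packNum (A : Set X) (s : ℝ) : ℕ :=
  sSup {n | ∃ T : Finset X, ↑T ⊆ A ∧ (T : Set X).Pairwise (fun x y => s < dist x y) ∧ T.card = n}

theorem exists_card_le_of_totallyBounded {A : Set X} (hA : TotallyBounded A) {s : ℝ} (hs : 0 < s) :
    ∃ n : ℕ, ∀ T : Finset X, ↑T ⊆ A → (T : Set X).Pairwise (fun x y => s < dist x y) →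
      T.card ≤ n := by
  obtain ⟨C, hC, hAC⟩ := Metric.totallyBounded_iff.1 hA (s / 2) (by positivity)
  refine ⟨hC.toFinset.card, fun T hT hsep => ?_⟩
  have : ∀ x ∈ T, ∃ c ∈ hC.toFinset, dist x c < s / 2 := by
    intro x hx
    obtain ⟨c, hc, hxc⟩ := Set.mem_iUnion₂.1 (hAC (hT hx))
    exact ⟨c, hC.mem_toFinset.2 hc, hxc⟩
  choose! f hf hd using this
  refine Finset.card_le_card_of_injOn f hf fun x hx y hy hxy => ?_
  by_contra hne
  have h1 := hsep hx hy hne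
  have h2 := hd x hx
  have h3 := hd y hy
  rw [← hxy] at h3
  linarith [dist_triangle_right x y (f x)]

theorem packNum_bddAbove {A : Set X} (hA : TotallyBounded A) {s : ℝ} (hs : 0 < s) :
    BddAbove {n | ∃ T : Finset X, ↑T ⊆ A ∧
      (T : Set X).Pairwise (fun x y => s < dist x y) ∧ T.card = n} := by
  obtain ⟨n, hn⟩ := exists_card_le_of_totallyBounded hA hs
  exact ⟨n, by rintro _ ⟨T, h1, h2, rfl⟩; exact hn T h1 h2⟩

theorem card_le_packNum {A : Set X} (hA : TotallyBounded A) {s : ℝ} (hs : 0 < s) {T : Finset X}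
    (hT : ↑T ⊆ A) (hsep : (T : Set X).Pairwise (fun x y => s < dist x y)) :
    T.card ≤ packNum A s :=
  le_csSup (packNum_bddAbove hA hs) ⟨T, hT, hsep, rfl⟩

theorem packNum_le {A : Set X} {s : ℝ} {n : ℕ}
    (h : ∀ T : Finset X, ↑T ⊆ A → (T : Set X).Pairwise (fun x y => s < dist x y) → T.card ≤ n) :
    packNum A s ≤ n :=
  csSup_le ⟨0, ∅, by simp⟩ (by rintro _ ⟨T, h1, h2, rfl⟩; exact h T h1 h2)

theorem exists_card_eq_packNum {A : Set X} (hA : TotallyBounded A) {s : ℝ} (hs : 0 < s) :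
    ∃ T : Finset X, ↑T ⊆ A ∧ (T : Set X).Pairwise (fun x y => s < dist x y) ∧
      T.card = packNum A s :=
  Nat.sSup_mem (s := {n | ∃ T : Finset X, (T : Set X) ⊆ A ∧
      (T : Set X).Pairwise (fun x y => s < dist x y) ∧ T.card = n})
    ⟨0, ∅, by simp⟩ (packNum_bddAbove hA hs)

theorem packNum_mono {A B : Set X} (hB : TotallyBounded B) (hAB : A ⊆ B) {s t : ℝ} (hs : 0 < s)
    (hst : s ≤ t) : packNum A t ≤ packNum B s :=
  packNum_le fun _ hT hsep => card_le_packNum hB hs (hT.trans hAB)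
    (hsep.imp fun _ _ h => hst.trans_lt h)

open Classical in
theorem packNum_le_sum {κ : Type*} (S : Finset κ) {A : Set X} (B : κ → Set X)
    (hB : ∀ i ∈ S, TotallyBounded (B i)) (hAB : ∀ x ∈ A, ∃ i ∈ S, x ∈ B i) {s : ℝ} (hs : 0 < s) :
    packNum A s ≤ ∑ i ∈ S, packNum (B i) s := by
  refine packNum_le fun T hT hsep => ?_
  calc T.card ≤ (S.biUnion fun i => T.filter (· ∈ B i)).card := by
        refine Finset.card_le_card fun x hx => ?_
        obtain ⟨i, hi, hxi⟩ := hAB x (hT hx)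
        exact Finset.mem_biUnion.2 ⟨i, hi, Finset.mem_filter.2 ⟨hx, hxi⟩⟩
    _ ≤ ∑ i ∈ S, (T.filter (· ∈ B i)).card := Finset.card_biUnion_le
    _ ≤ ∑ i ∈ S, packNum (B i) s := Finset.sum_le_sum fun i hi =>
        card_le_packNum (hB i hi) hs (fun x hx => (Finset.mem_filter.1 hx).2)
          (hsep.mono (Finset.coe_subset.2 (Finset.filter_subset _ _)))

open Classical in
theorem packNum_image {f : X → X} {ρ : ℝ} (hρ : 0 < ρ) (hf : IsSimilarity f ρ) (A : Set X) (s : ℝ) :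
    packNum (f '' A) s = packNum A (s / ρ) := by
  have hinj := hf.injective hρ
  unfold packNum
  congr 1
  ext n
  constructor
  · rintro ⟨T, hT, hsep, rfl⟩
    obtain ⟨U, hU, rfl⟩ := (Finset.subset_set_image_iff (s := A) (t := T) (f := f)).1 hT
    refine ⟨U, hU, fun x hx y hy hxy => ?_, (Finset.card_image_of_injective _ hinj).symm⟩
    change s / ρ < dist x y
    rw [div_lt_iff₀' hρ, ← hf x y]
    exact hsep (Finset.mem_coe.2 (Finset.mem_image_of_mem f hx))
      (Finset.mem_coe.2 (Finset.mem_image_of_mem f hy)) (hinj.ne hxy)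
  · rintro ⟨U, hU, hsep, rfl⟩
    refine ⟨U.image f, by simpa using hU.trans (Set.subset_preimage_image f A), ?_,
      Finset.card_image_of_injective _ hinj⟩
    rw [Finset.coe_image, hinj.injOn.pairwise_image]
    intro x hx y hy hxy
    have h : s / ρ < dist x y := hsep hx hy hxy
    rwa [div_lt_iff₀' hρ, ← hf x y] at h

open Classical in
/-- Near-superadditivity of the packing number: the defect is controlled by the points of each
piece that lie close to another piece. -/
theorem sum_packNum_le {κ : Type*} [Fintype κ] {A : Set X} (hA : TotallyBounded A)
    (B : κ → Set X) (hB : ∀ i, B i ⊆ A) {s : ℝ} (hs : 0 < s) :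
    ∑ i, packNum (B i) s ≤ packNum A s +
      ∑ i, packNum (B i ∩ {y | ∃ j, j ≠ i ∧ ∃ z ∈ B j, dist y z ≤ s}) s := by
  choose T hT hsep hcard using fun i => exists_card_eq_packNum (hA.subset (hB i)) hs
  set G : κ → Set X := fun i => {y | ∃ j, j ≠ i ∧ ∃ z ∈ B j, dist y z ≤ s} with hG
  have hfar : ∀ i j, i ≠ j → ∀ x ∈ (T i).filter (· ∉ G i), ∀ y ∈ (T j).filter (· ∉ G j),
      s < dist x y := by
    intro i j hij x hx y hy
    by_contra! hle
    exact (Finset.mem_filter.1 hx).2 ⟨j, hij.symm, y, hT j (Finset.mem_filter.1 hy).1, hle⟩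
  have hmain : ∑ i, ((T i).filter (· ∉ G i)).card ≤ packNum A s := by
    rw [← Finset.card_biUnion]
    · refine card_le_packNum hA hs ?_ ?_
      · intro x hx
        obtain ⟨i, -, hx⟩ := Finset.mem_biUnion.1 hx
        exact hB i (hT i (Finset.mem_filter.1 hx).1)
      · intro x hx y hy hxy
        obtain ⟨i, -, hx⟩ := Finset.mem_biUnion.1 hx
        obtain ⟨j, -, hy⟩ := Finset.mem_biUnion.1 hy
        rcases eq_or_ne i j with rfl | hij
        · exact hsep i (Finset.mem_filter.1 hx).1 (Finset.mem_filter.1 hy).1 hxy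
        · exact hfar i j hij x hx y hy
    · intro i _ j _ hij
      refine Finset.disjoint_left.2 fun x hx hx' => ?_
      have := hfar i j hij x hx x hx'
      rw [dist_self] at this
      exact this.not_gt hs
  calc ∑ i, packNum (B i) s
      = ∑ i, (((T i).filter (· ∉ G i)).card + ((T i).filter (· ∈ G i)).card) := by
        refine Finset.sum_congr rfl fun i _ => ?_
        rw [← hcard, add_comm, Finset.card_filter_add_card_filter_not]
    _ ≤ packNum A s + ∑ i, packNum (B i ∩ G i) s := by
        rw [Finset.sum_add_distrib]
        refine add_le_add hmain (Finset.sum_le_sum fun i _ => ?_)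
        refine card_le_packNum (hA.subset (Set.inter_subset_left.trans (hB i))) hs ?_
          ((hsep i).mono (Finset.coe_subset.2 (Finset.filter_subset _ _)))
        intro x hx
        exact ⟨hT i (Finset.mem_filter.1 hx).1, (Finset.mem_filter.1 hx).2⟩

/-- A maximal packing is a covering. -/
theorem exists_cover_card_eq_packNum {A : Set X} (hA : TotallyBounded A) {s : ℝ} (hs : 0 < s) :
    ∃ T : Finset X, T.card = packNum A s ∧ ∀ x ∈ A, ∃ q ∈ T, dist x q ≤ s := by
  classical
  obtain ⟨T, hT, hsep, hcard⟩ := exists_card_eq_packNum hA hs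
  refine ⟨T, hcard, fun x hx => ?_⟩
  by_contra! hfar
  have hxT : x ∉ T := fun h => by
    have := hfar x h
    rw [dist_self] at this
    exact this.not_gt hs
  have := card_le_packNum hA hs (T := insert x T)
    (by rw [Finset.coe_insert]; exact Set.insert_subset hx hT)
    (by
      rw [Finset.coe_insert]
      refine hsep.insert fun y hy _ => ⟨hfar y hy, ?_⟩
      rw [dist_comm]
      exact hfar y hy)
  rw [Finset.card_insert_of_notMem hxT, hcard] at this
  omega

end Packing

section Words

variable {ι X : Type*}

/-- The composition of the maps `φ j` along a word. -/
def wordMap (φ : ι → X → X) : List ι → X → X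
  | [] => id
  | j :: l => φ j ∘ wordMap φ l

/-- The product of the ratios `r j` along a word. -/
def wordRatio (r : ι → ℝ) (l : List ι) : ℝ := (l.map r).prod

/-- The words whose ratio is at most `s` but all of whose proper prefixes have ratio
greater than `s`. -/
def cutSet (r : ι → ℝ) (s : ℝ) : Set (List ι) :=
  {l | wordRatio r l ≤ s ∧ (l ≠ [] → s < wordRatio r l.dropLast)}

@[simp] theorem wordRatio_nil (r : ι → ℝ) : wordRatio r [] = 1 := rfl

@[simp] theorem wordRatio_cons (r : ι → ℝ) (j : ι) (l : List ι) :
    wordRatio r (j :: l) = r j * wordRatio r l := by simp [wordRatio]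

@[simp] theorem wordRatio_append (r : ι → ℝ) (l l' : List ι) :
    wordRatio r (l ++ l') = wordRatio r l * wordRatio r l' := by simp [wordRatio]

theorem wordMap_append (φ : ι → X → X) (l l' : List ι) :
    wordMap φ (l ++ l') = wordMap φ l ∘ wordMap φ l' := by
  induction l with
  | nil => rfl
  | cons j l ih => simp [wordMap, ih, Function.comp_assoc]

theorem wordMap_image_append (φ : ι → X → X) (l l' : List ι) (A : Set X) :
    wordMap φ (l ++ l') '' A = wordMap φ l '' (wordMap φ l' '' A) := by
  rw [wordMap_append, Set.image_comp]

theorem wordMap_image_cons (φ : ι → X → X) (j : ι) (l : List ι) (A : Set X) :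
    wordMap φ (j :: l) '' A = φ j '' (wordMap φ l '' A) :=
  Set.image_comp (φ j) (wordMap φ l) A

theorem wordMap_image_subset {φ : ι → X → X} {A : Set X} (hA : ∀ j, φ j '' A ⊆ A) (l : List ι) :
    wordMap φ l '' A ⊆ A := by
  induction l with
  | nil => simp [wordMap]
  | cons j l ih => exact (wordMap_image_cons φ j l A).trans_subset ((Set.image_mono ih).trans (hA j))

theorem wordMap_surjective {φ : ι → X → X} (hφ : ∀ j, Function.Surjective (φ j)) (l : List ι) :
    Function.Surjective (wordMap φ l) := by
  induction l with
  | nil => exact Function.surjective_id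
  | cons j l ih => exact (hφ j).comp ih

theorem exists_word_of_length {φ : ι → X → X} {F : Set X} (hF : F = ⋃ j, φ j '' F) (n : ℕ) :
    ∀ z ∈ F, ∃ v : Fin n → ι, z ∈ wordMap φ (List.ofFn v) '' F := by
  induction n with
  | zero => exact fun z hz => ⟨Fin.elim0, by simpa [wordMap] using hz⟩
  | succ n ih =>
    intro z hz
    rw [hF] at hz
    obtain ⟨j, z', hz', rfl⟩ := Set.mem_iUnion.1 hz
    obtain ⟨v, hv⟩ := ih z' hz'
    refine ⟨Fin.cons j v, ?_⟩
    rw [List.ofFn_cons, wordMap_image_cons]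
    exact Set.mem_image_of_mem _ hv

section Ratio

variable {r : ι → ℝ}

theorem wordRatio_pos (hr : ∀ j, r j ∈ Set.Ioo (0 : ℝ) 1) (l : List ι) : 0 < wordRatio r l := by
  induction l with
  | nil => simp
  | cons j l ih => rw [wordRatio_cons]; exact mul_pos (hr j).1 ih

theorem wordRatio_le_one (hr : ∀ j, r j ∈ Set.Ioo (0 : ℝ) 1) (l : List ι) :
    wordRatio r l ≤ 1 := by
  induction l with
  | nil => simp
  | cons j l ih =>
    rw [wordRatio_cons]
    exact mul_le_one₀ (hr j).2.le (wordRatio_pos hr l).le ih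

theorem wordRatio_cons_lt_one (hr : ∀ j, r j ∈ Set.Ioo (0 : ℝ) 1) (j : ι) (l : List ι) :
    wordRatio r (j :: l) < 1 := by
  rw [wordRatio_cons]
  have := wordRatio_le_one hr l
  nlinarith [hr j |>.1, hr j |>.2]

theorem cons_mem_cutSet (hr : ∀ j, r j ∈ Set.Ioo (0 : ℝ) 1) {s : ℝ} (hs : s < 1) {j : ι}
    {l : List ι} (hl : l ∈ cutSet r (s / r j)) : j :: l ∈ cutSet r s := by
  obtain ⟨h1, h2⟩ := hl
  have hj := (hr j).1
  refine ⟨?_, fun _ => ?_⟩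
  · rw [wordRatio_cons]
    rwa [le_div_iff₀' hj] at h1
  · rcases eq_or_ne l [] with rfl | hne
    · simpa using hs
    · have := h2 hne
      rwa [div_lt_iff₀' hj, ← wordRatio_cons, ← List.dropLast_cons_of_ne_nil hne] at this

theorem append_mem_cutSet (hr : ∀ j, r j ∈ Set.Ioo (0 : ℝ) 1) {k l : List ι}
    (hl : l ∈ cutSet r (wordRatio r k)) (w : List ι) :
    w ++ l ∈ cutSet r (wordRatio r (w ++ k)) := by
  induction w with
  | nil => exact hl
  | cons j w ih =>
    refine cons_mem_cutSet hr (wordRatio_cons_lt_one hr j _) ?_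
    rw [wordRatio_cons, mul_div_cancel_left₀ _ (hr j).1.ne']
    exact ih

theorem eq_of_prefix_of_mem_cutSet (hr : ∀ j, r j ∈ Set.Ioo (0 : ℝ) 1) {s : ℝ} {l l' : List ι}
    (hl : l ∈ cutSet r s) (hl' : l' ∈ cutSet r s) (h : l <+: l') : l = l' := by
  obtain ⟨t, rfl⟩ := h
  rcases eq_or_ne t [] with rfl | ht
  · simp
  · have h1 := hl'.2 (by simp [ht])
    rw [List.dropLast_append_of_ne_nil ht, wordRatio_append] at h1
    have h2 := wordRatio_le_one hr t.dropLast
    have h3 := wordRatio_pos hr l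
    have h4 := hl.1
    nlinarith

theorem mul_le_wordRatio_of_mem_cutSet {c : ℝ} (hc : 0 < c) (hcr : ∀ j, c ≤ r j)
    {s : ℝ} (hs : 0 < s) {l : List ι} (hl : l ∈ cutSet r s) (hne : l ≠ []) :
    c * s ≤ wordRatio r l := by
  have h1 := hl.2 hne
  rw [← List.dropLast_append_getLast hne, wordRatio_append, wordRatio_cons, wordRatio_nil, mul_one]
  nlinarith [hcr (l.getLast hne)]

/-- Induction on the scale, from a scale `s < 1` to the scales `s / r j`. -/
theorem scale_induction [Finite ι] (hr : ∀ j, r j ∈ Set.Ioo (0 : ℝ) 1) {P : ℝ → Prop}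
    (h1 : ∀ s, 1 ≤ s → P s) (h2 : ∀ s, 0 < s → s < 1 → (∀ j, P (s / r j)) → P s) {s : ℝ}
    (hs : 0 < s) : P s := by
  obtain ⟨ρ, hρ0, hρ1, hρ⟩ : ∃ ρ : ℝ, 0 < ρ ∧ ρ < 1 ∧ ∀ j, r j ≤ ρ := by
    rcases isEmpty_or_nonempty ι with h | h
    · exact ⟨1 / 2, by norm_num, by norm_num, fun j => h.elim j⟩
    · obtain ⟨j, hj⟩ := Finite.exists_max r
      exact ⟨r j, (hr j).1, (hr j).2, hj⟩
  have key : ∀ n : ℕ, ∀ s, 0 < s → ρ ^ n ≤ s → P s := by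
    intro n
    induction n with
    | zero => exact fun s _ h => h1 s (by simpa using h)
    | succ n ih =>
      intro s hs hn
      rcases le_or_gt 1 s with h | h
      · exact h1 s h
      · refine h2 s hs h fun j => ih _ (div_pos hs (hr j).1) ?_
        rw [le_div_iff₀ (hr j).1]
        refine le_trans ?_ hn
        rw [pow_succ]
        gcongr
        exact hρ j
  obtain ⟨n, hn⟩ := exists_pow_lt_of_lt_one hs hρ1
  exact key n s hs hn.le

theorem nil_mem_cutSet {s : ℝ} (hs : 1 ≤ s) : [] ∈ cutSet r s := ⟨hs, fun h => (h rfl).elim⟩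

theorem exists_mem_cutSet [Finite ι] (hr : ∀ j, r j ∈ Set.Ioo (0 : ℝ) 1) {φ : ι → X → X}
    {F : Set X} (hF : F = ⋃ j, φ j '' F) {s : ℝ} (hs : 0 < s) :
    ∀ z ∈ F, ∃ l ∈ cutSet r s, z ∈ wordMap φ l '' F := by
  refine scale_induction hr (P := fun s => ∀ z ∈ F, ∃ l ∈ cutSet r s, z ∈ wordMap φ l '' F)
    (fun s hs z hz => ⟨[], nil_mem_cutSet hs, by simpa [wordMap] using hz⟩) ?_ hs
  intro s _ hs1 ih z hz
  rw [hF] at hz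
  obtain ⟨j, z', hz', rfl⟩ := Set.mem_iUnion.1 hz
  obtain ⟨l, hl, hlz⟩ := ih j z' hz'
  refine ⟨j :: l, cons_mem_cutSet hr hs1 hl, ?_⟩
  rw [wordMap_image_cons]
  exact Set.mem_image_of_mem _ hlz

open Classical in
theorem exists_finset_cutSet [Fintype ι] (hr : ∀ j, r j ∈ Set.Ioo (0 : ℝ) 1) {D : ℝ} (hD0 : 0 ≤ D)
    (hD : ∑ j, r j ^ D = 1) {s : ℝ} (hs : 0 < s) :
    ∃ T : Finset (List ι), ↑T ⊆ cutSet r s ∧ s ^ (-D) ≤ T.card := by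
  refine scale_induction hr (P := fun s => ∃ T : Finset (List ι), ↑T ⊆ cutSet r s ∧
    s ^ (-D) ≤ T.card) (fun s hs => ⟨{[]}, ?_, ?_⟩) ?_ hs
  · simpa using nil_mem_cutSet hs
  · simpa using Real.rpow_le_one_of_one_le_of_nonpos hs (neg_nonpos.2 hD0)
  intro s hs hs1 ih
  choose T hT hcard using ih
  refine ⟨Finset.univ.biUnion fun j => (T j).image (List.cons j), ?_, ?_⟩
  · intro l hl
    obtain ⟨j, -, hl⟩ := Finset.mem_biUnion.1 hl
    obtain ⟨l', hl', rfl⟩ := Finset.mem_image.1 hl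
    exact cons_mem_cutSet hr hs1 (hT j hl')
  · rw [Finset.card_biUnion]
    · push_cast
      calc s ^ (-D) = ∑ j, (s / r j) ^ (-D) := by
            rw [← mul_one (s ^ (-D)), ← hD, Finset.mul_sum]
            refine Finset.sum_congr rfl fun j _ => ?_
            rw [Real.div_rpow hs.le (hr j).1.le, Real.rpow_neg (hr j).1.le, div_inv_eq_mul]
        _ ≤ _ := Finset.sum_le_sum fun j _ => by
            rw [Finset.card_image_of_injective _ (List.cons_injective)]
            exact hcard j
    · intro i _ j _ hij
      refine Finset.disjoint_left.2 fun l hl hl' => hij ?_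
      obtain ⟨l, -, rfl⟩ := Finset.mem_image.1 hl
      obtain ⟨l', -, h⟩ := Finset.mem_image.1 hl'
      exact (List.cons.inj h).1.symm

end Ratio

theorem disjoint_wordMap_image {φ : ι → X → X} (hinj : ∀ j, Function.Injective (φ j)) {V : Set X}
    (hV : ∀ j, φ j '' V ⊆ V) (hdisj : Pairwise fun i j => Disjoint (φ i '' V) (φ j '' V)) :
    ∀ {l l' : List ι}, ¬ l <+: l' → ¬ l' <+: l → Disjoint (wordMap φ l '' V) (wordMap φ l' '' V)
  | [], _, h, _ => (h List.nil_prefix).elim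
  | _ :: _, [], _, h => (h List.nil_prefix).elim
  | a :: l, b :: l', h, h' => by
    rw [wordMap_image_cons, wordMap_image_cons]
    rcases eq_or_ne a b with rfl | hab
    · rw [Set.disjoint_image_iff (hinj a)]
      exact disjoint_wordMap_image hinj hV hdisj (fun hp => h (by simpa using hp))
        (fun hp => h' (by simpa using hp))
    · exact (hdisj hab).mono (Set.image_mono (wordMap_image_subset hV l))
        (Set.image_mono (wordMap_image_subset hV l'))

end Words

section Metric

variable {ι X : Type*} [MetricSpace X] {φ : ι → X → X} {r : ι → ℝ}

theorem dist_wordMap (hsim : ∀ j, IsSimilarity (φ j) (r j)) (l : List ι) (x y : X) :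
    dist (wordMap φ l x) (wordMap φ l y) = wordRatio r l * dist x y := by
  induction l with
  | nil => simp [wordMap]
  | cons j l ih =>
    rw [wordRatio_cons, mul_assoc, ← ih]
    exact hsim j _ _

/-- Under the open set condition, the images of a point of the open set under the words of a
cut set at scale `s` are separated at scale `s`. -/
theorem le_dist_of_mem_cutSet (hr : ∀ j, r j ∈ Set.Ioo (0 : ℝ) 1)
    (hsim : ∀ j, IsSimilarity (φ j) (r j)) (hsurj : ∀ j, Function.Surjective (φ j)) {V : Set X}
    (hV : ∀ j, φ j '' V ⊆ V) (hdisj : Pairwise fun i j => Disjoint (φ i '' V) (φ j '' V))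
    {a : X} {ρ : ℝ} (hρ : 0 < ρ) (haV : ball a ρ ⊆ V) {c : ℝ} (hc : 0 < c) (hcr : ∀ j, c ≤ r j)
    {s : ℝ} (hs : 0 < s) {l l' : List ι} (hl : l ∈ cutSet r s) (hl' : l' ∈ cutSet r s)
    (hne : l ≠ l') : c * s * ρ ≤ dist (wordMap φ l a) (wordMap φ l' a) := by
  have h1 : ¬ l <+: l' := fun h => hne (eq_of_prefix_of_mem_cutSet hr hl hl' h)
  have h2 : ¬ l' <+: l := fun h => hne (eq_of_prefix_of_mem_cutSet hr hl' hl h).symm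
  have hnil : l ≠ [] := by
    rintro rfl
    exact h1 List.nil_prefix
  have hd := disjoint_wordMap_image (fun j => (hsim j).injective (hr j).1) hV hdisj h1 h2
  have hrl := mul_le_wordRatio_of_mem_cutSet hc hcr hs hl hnil
  refine (mul_le_mul_of_nonneg_right hrl hρ.le).trans ?_
  by_contra! hlt
  obtain ⟨z, hz⟩ := wordMap_surjective hsurj l (wordMap φ l' a)
  rw [← hz, dist_wordMap hsim] at hlt
  have hza : z ∈ ball a ρ := by
    rw [mem_ball, dist_comm]
    exact lt_of_mul_lt_mul_left hlt (wordRatio_pos hr l).le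
  exact Set.disjoint_left.1 hd ⟨z, haV hza, hz⟩ ⟨a, haV (mem_ball_self hρ), rfl⟩

/-- If at every scale only boundedly many cylinders come near any given point, then some word `k`
is isolated: a cylinder ending in `k` stays away, relative to its size, from all the first-level
pieces other than its own. -/
theorem exists_isolated_word [Finite ι] (hr : ∀ j, r j ∈ Set.Ioo (0 : ℝ) 1)
    (hsim : ∀ j, IsSimilarity (φ j) (r j)) {F : Set X} (hF : F = ⋃ j, φ j '' F) {a : X} {Δ : ℝ}
    (hΔ : ∀ y ∈ F, dist a y ≤ Δ) {γ : ℕ}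
    (hγ : ∀ s, 0 < s → ∀ (p : X) (T : Finset (List ι)),
      (∀ l ∈ T, l ∈ cutSet r s ∧ dist (wordMap φ l a) p ≤ (2 * Δ + 1) * s) → T.card ≤ γ) :
    ∃ k : List ι, ∀ b j, j ≠ b → ∀ w, ∀ y ∈ wordMap φ (b :: w ++ k) '' F, ∀ z ∈ φ j '' F,
      wordRatio r (b :: w ++ k) ≤ dist y z := by
  classical
  set I : List ι → Set (List ι) := fun w => {l | l ∈ cutSet r (wordRatio r w) ∧
    ∃ y ∈ wordMap φ l '' F, ∃ z ∈ wordMap φ w '' F, dist y z < wordRatio r w} with hI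
  set C : Set ℕ := {n | ∃ w, ∃ T : Finset (List ι), (T : Set (List ι)) ⊆ I w ∧ T.card = n}
  have hbdd : BddAbove C := by
    refine ⟨γ, ?_⟩
    rintro _ ⟨w, T, hT, rfl⟩
    refine hγ _ (wordRatio_pos hr w) (wordMap φ w a) T fun l hl => ?_
    obtain ⟨hcut, _, ⟨y, hy, rfl⟩, _, ⟨z, hz, rfl⟩, hyz⟩ := hT hl
    refine ⟨hcut, ?_⟩
    have h1 : dist (wordMap φ l a) (wordMap φ l y) ≤ wordRatio r w * Δ := by
      rw [dist_wordMap hsim]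
      exact mul_le_mul hcut.1 (hΔ y hy) dist_nonneg (wordRatio_pos hr w).le
    have h2 : dist (wordMap φ w a) (wordMap φ w z) ≤ wordRatio r w * Δ := by
      rw [dist_wordMap hsim]
      exact mul_le_mul_of_nonneg_left (hΔ z hz) (wordRatio_pos hr w).le
    rw [dist_comm] at h2
    linarith [dist_triangle4 (wordMap φ l a) (wordMap φ l y) (wordMap φ w z) (wordMap φ w a)]
  obtain ⟨k, T, hT, hcard⟩ : sSup C ∈ C := Nat.sSup_mem ⟨0, [], ∅, by simp, rfl⟩ hbdd
  have hmax : ∀ w, ∀ l ∈ I (w ++ k), ∃ l' ∈ T, w ++ l' = l := by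
    intro w l hl
    by_contra! hcon
    have hmem : l ∉ T.image (w ++ ·) := fun h => by
      obtain ⟨l', h1, h2⟩ := Finset.mem_image.1 h
      exact hcon l' h1 h2
    have hsub : ((insert l (T.image (w ++ ·)) : Finset (List ι)) : Set (List ι)) ⊆ I (w ++ k) := by
      intro l' hl'
      rcases Finset.mem_insert.1 hl' with rfl | hl'
      · exact hl
      · obtain ⟨l'', hl'', rfl⟩ := Finset.mem_image.1 hl'
        obtain ⟨hcut, y, hy, z, hz, hyz⟩ := hT hl''
        refine ⟨append_mem_cutSet hr hcut w, wordMap φ w y, ?_, wordMap φ w z, ?_, ?_⟩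
        · rw [wordMap_image_append]
          exact Set.mem_image_of_mem _ hy
        · rw [wordMap_image_append]
          exact Set.mem_image_of_mem _ hz
        · rw [dist_wordMap hsim, wordRatio_append]
          exact mul_lt_mul_of_pos_left hyz (wordRatio_pos hr w)
    have := le_csSup hbdd ⟨w ++ k, _, hsub, rfl⟩
    rw [Finset.card_insert_of_notMem hmem,
      Finset.card_image_of_injective _ (List.append_right_injective w), hcard] at this
    omega
  refine ⟨k, fun b j hjb w y hy z hz => ?_⟩
  by_contra! hlt
  obtain ⟨z, hz, rfl⟩ := hz
  have hs := wordRatio_pos hr (b :: w ++ k)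
  obtain ⟨l, hl, hlz⟩ := exists_mem_cutSet hr hF (div_pos hs (hr j).1) z hz
  obtain ⟨l', -, h⟩ := hmax (b :: w) (j :: l) ⟨cons_mem_cutSet hr
    (wordRatio_cons_lt_one hr b (w ++ k)) hl, φ j z, by
      rw [wordMap_image_cons]; exact Set.mem_image_of_mem _ hlz, y, hy, by rwa [dist_comm]⟩
  exact hjb (List.cons.inj h).1.symm

/-- Given an isolated word, the number of `s`-separated points of a first-level piece that lie
within `s` of another piece grows with an exponent `D'` smaller than the similarity dimension. -/
theorem packNum_overlap_le [Fintype ι] [Nonempty ι] (hr : ∀ j, r j ∈ Set.Ioo (0 : ℝ) 1)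
    (hsim : ∀ j, IsSimilarity (φ j) (r j)) {F : Set X} (hFc : IsCompact F)
    (hF : F = ⋃ j, φ j '' F) {D : ℝ} (hD0 : 0 < D) (hD : ∑ j, r j ^ D = 1) {k : List ι}
    (hk : ∀ b j, j ≠ b → ∀ w, ∀ y ∈ wordMap φ (b :: w ++ k) '' F, ∀ z ∈ φ j '' F,
      wordRatio r (b :: w ++ k) ≤ dist y z) :
    ∃ D' < D, ∃ K s₀ : ℝ, 0 ≤ K ∧ 0 < s₀ ∧ ∀ b s, 0 < s → s ≤ s₀ →
      (packNum (φ b '' F ∩ {y | ∃ j, j ≠ b ∧ ∃ z ∈ φ j '' F, dist y z ≤ s}) s : ℝ)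
        ≤ K * s ^ (-D') := by
  classical
  obtain ⟨jmin, hjmin⟩ := Finite.exists_min r
  set c := r jmin
  have hc : 0 < c := (hr jmin).1
  set n := k.length
  set v₀ : Fin n → ι := k.get with hv₀
  have hofn : List.ofFn v₀ = k := List.ofFn_get k
  have hrpos := wordRatio_pos hr
  set κ := c * wordRatio r k with hκ
  have hκ0 : 0 < κ := mul_pos hc (hrpos k)
  -- an exponent for the words of length `n` other than `k`
  obtain ⟨D', hD'0, hD'D, hsum⟩ : ∃ D', 0 ≤ D' ∧ D' < D ∧
      ∑ v ∈ Finset.univ.erase v₀, wordRatio r (List.ofFn v) ^ D' ≤ 1 := by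
    have hsumD : ∑ v ∈ Finset.univ.erase v₀, wordRatio r (List.ofFn v) ^ D < 1 := by
      have htot : ∑ v : Fin n → ι, wordRatio r (List.ofFn v) ^ D = 1 := by
        have := Fintype.sum_pow (fun j => r j ^ D) n
        rw [hD, one_pow] at this
        rw [this]
        refine Finset.sum_congr rfl fun v _ => ?_
        rw [Real.finsetProd_rpow _ _ fun i _ => (hr (v i)).1.le, wordRatio, List.map_ofFn,
          List.prod_ofFn]
        rfl
      rw [← htot, ← Finset.add_sum_erase _ _ (Finset.mem_univ v₀)]
      have := Real.rpow_pos_of_pos (hrpos (List.ofFn v₀)) D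
      linarith
    have hcont : Continuous fun x : ℝ =>
        ∑ v ∈ Finset.univ.erase v₀, wordRatio r (List.ofFn v) ^ x :=
      continuous_finsetSum _ fun v _ => Real.continuous_const_rpow (hrpos _).ne'
    have h1 : ∀ᶠ x in 𝓝[<] D,
        ∑ v ∈ Finset.univ.erase v₀, wordRatio r (List.ofFn v) ^ x < 1 :=
      (hcont.continuousAt.eventually (gt_mem_nhds hsumD)).filter_mono nhdsWithin_le_nhds
    have h2 : ∀ᶠ x in 𝓝[<] D, 0 < x := (lt_mem_nhds hD0).filter_mono nhdsWithin_le_nhds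
    obtain ⟨x, ⟨h1, h2⟩, h3⟩ := ((h1.and h2).and self_mem_nhdsWithin).exists
    exact ⟨x, h2.le, h3, h1.le⟩
  set c₀ := c ^ n / κ with hc₀
  have hc₀0 : 0 < c₀ := by positivity
  have hcn : ∀ v : Fin n → ι, c ^ n ≤ wordRatio r (List.ofFn v) := by
    intro v
    rw [wordRatio, List.map_ofFn, List.prod_ofFn]
    calc c ^ n = ∏ _i : Fin n, c := by simp
      _ ≤ _ := Finset.prod_le_prod (fun _ _ => hc.le) fun i _ => hjmin (v i)
  have htb := hFc.totallyBounded
  have hsub : ∀ l, wordMap φ l '' F ⊆ F := wordMap_image_subset fun j => by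
    conv_rhs => rw [hF]
    exact Set.subset_iUnion (fun j => φ j '' F) j
  set K₀ : ℝ := (packNum F κ : ℝ) with hK₀
  have hK₀0 : 0 ≤ K₀ := Nat.cast_nonneg _
  set K := K₀ / c₀ ^ D' with hK
  have hcD : 0 < c₀ ^ D' := Real.rpow_pos_of_pos hc₀0 _
  have hK0 : 0 ≤ K := by positivity
  refine ⟨D', hD'D, K, 1 / c₀, hK0, by positivity, fun b s hs hs0 => ?_⟩
  set B : Set X := {y | ∃ j, j ≠ b ∧ ∃ z ∈ φ j '' F, dist y z ≤ s} with hB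
  obtain ⟨ρ, hρ0, hρ1, hρ⟩ : ∃ ρ, 0 < ρ ∧ ρ < 1 ∧ ∀ j, r j ≤ ρ := by
    obtain ⟨j, hj⟩ := Finite.exists_max r
    exact ⟨r j, (hr j).1, (hr j).2, hj⟩
  have hle : ∀ l : List ι, l ≠ [] → wordRatio r l ≤ ρ := by
    intro l hl
    obtain ⟨j, l, rfl⟩ := List.exists_cons_of_ne_nil hl
    rw [wordRatio_cons]
    exact (mul_le_of_le_one_right (hr j).1.le (wordRatio_le_one hr l)).trans (hρ j)
  have key : ∀ (N : ℕ) (w : List ι), c₀ * s ≤ wordRatio r w → κ * wordRatio r w * ρ ^ N ≤ s →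
      (packNum (wordMap φ (b :: w) '' F ∩ B) s : ℝ) ≤ K * (wordRatio r w / s) ^ D' := by
    have hbase : ∀ w : List ι, c₀ * s ≤ wordRatio r w → κ * wordRatio r w ≤ s →
        (packNum (wordMap φ (b :: w) '' F ∩ B) s : ℝ) ≤ K * (wordRatio r w / s) ^ D' := by
      intro w hw hws
      have hrw := hrpos w
      calc (packNum (wordMap φ (b :: w) '' F ∩ B) s : ℝ)
          ≤ packNum (wordMap φ (b :: w) '' F) s := by
            exact_mod_cast packNum_mono (htb.subset (hsub _)) Set.inter_subset_left hs le_rfl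
        _ = packNum F (s / wordRatio r (b :: w)) := by
            rw [packNum_image (hrpos _) (dist_wordMap hsim _)]
        _ ≤ K₀ := by
            rw [hK₀]
            refine Nat.cast_le.2 (packNum_mono htb subset_rfl hκ0 ?_)
            rw [le_div_iff₀ (hrpos _), wordRatio_cons]
            refine le_trans ?_ hws
            refine mul_le_mul_of_nonneg_left ?_ hκ0.le
            exact mul_le_of_le_one_left hrw.le (hr b).2.le
        _ = K * c₀ ^ D' := by rw [hK, div_mul_cancel₀ _ hcD.ne']
        _ ≤ _ := by
            refine mul_le_mul_of_nonneg_left ?_ hK0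
            exact Real.rpow_le_rpow hc₀0.le ((le_div_iff₀ hs).2 hw) hD'0
    intro N
    induction N with
    | zero => exact fun w hw hws => hbase w hw (by simpa using hws)
    | succ N ih =>
      intro w hw hws
      rcases le_or_gt (κ * wordRatio r w) s with hlt | hlt
      · exact hbase w hw hlt
      have hrw := hrpos w
      have hsplit : packNum (wordMap φ (b :: w) '' F ∩ B) s ≤ ∑ v ∈ Finset.univ.erase v₀,
          packNum (wordMap φ (b :: (w ++ List.ofFn v)) '' F ∩ B) s := by
        refine packNum_le_sum _ _
          (fun v _ => htb.subset (Set.inter_subset_left.trans (hsub _))) ?_ hs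
        rintro _ ⟨⟨z, hz, rfl⟩, hyB⟩
        obtain ⟨v, hv⟩ := exists_word_of_length hF n z hz
        have hy : wordMap φ (b :: w) z ∈ wordMap φ (b :: (w ++ List.ofFn v)) '' F := by
          rw [← List.cons_append, wordMap_image_append]
          exact Set.mem_image_of_mem _ hv
        refine ⟨v, Finset.mem_erase.2 ⟨?_, Finset.mem_univ v⟩, hy, hyB⟩
        rintro rfl
        rw [hofn] at hy
        obtain ⟨j, hjb, x, hx, hyx⟩ := hyB
        have h1 := (hk b j hjb w _ hy x hx).trans hyx
        rw [List.cons_append, wordRatio_cons, wordRatio_append] at h1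
        have h2 : κ * wordRatio r w ≤ r b * (wordRatio r w * wordRatio r k) := by
          rw [hκ, mul_assoc, mul_comm (wordRatio r k)]
          exact mul_le_mul_of_nonneg_right (hjmin b) (mul_pos hrw (hrpos k)).le
        linarith
      calc (packNum (wordMap φ (b :: w) '' F ∩ B) s : ℝ)
          ≤ ∑ v ∈ Finset.univ.erase v₀,
            (packNum (wordMap φ (b :: (w ++ List.ofFn v)) '' F ∩ B) s : ℝ) := by
              exact_mod_cast hsplit
        _ ≤ ∑ v ∈ Finset.univ.erase v₀,
            K * (wordRatio r w / s) ^ D' * wordRatio r (List.ofFn v) ^ D' := by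
              refine Finset.sum_le_sum fun v hv => ?_
              have hne : List.ofFn v ≠ [] := by
                intro h0
                have hn : n = 0 := by simpa using congrArg List.length h0
                refine (Finset.mem_erase.1 hv).1 (funext fun i => ?_)
                exact absurd i.2 (by omega)
              have hv0 := hrpos (List.ofFn v)
              refine (ih (w ++ List.ofFn v) ?_ ?_).trans_eq ?_
              · rw [wordRatio_append]
                calc c₀ * s = s / κ * c ^ n := by rw [hc₀]; ring
                  _ ≤ wordRatio r w * wordRatio r (List.ofFn v) := by
                    refine mul_le_mul ?_ (hcn v) (by positivity) hrw.le
                    rw [div_le_iff₀' hκ0]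
                    exact hlt.le
              · rw [wordRatio_append]
                refine le_trans ?_ hws
                rw [pow_succ', ← mul_assoc, ← mul_assoc]
                refine mul_le_mul_of_nonneg_right ?_ (by positivity)
                exact mul_le_mul_of_nonneg_left (hle _ hne) (by positivity)
              · rw [wordRatio_append, mul_div_right_comm,
                  Real.mul_rpow (by positivity) hv0.le, mul_assoc]
        _ ≤ K * (wordRatio r w / s) ^ D' := by
              rw [← Finset.mul_sum]
              exact mul_le_of_le_one_right
                (mul_nonneg hK0 (Real.rpow_nonneg (by positivity) _)) hsum
  obtain ⟨N, hN⟩ := exists_pow_lt_of_lt_one (div_pos hs hκ0) hρ1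
  have := key N [] (by rw [wordRatio_nil, ← le_div_iff₀' hc₀0]; exact hs0)
    (by rw [wordRatio_nil, mul_one, ← le_div_iff₀' hκ0]; exact hN.le)
  rw [wordMap_image_cons, wordRatio_nil, one_div, Real.inv_rpow hs.le, ← Real.rpow_neg hs.le] at this
  simpa [wordMap] using this

/-- A lower bound of the right order for the packing numbers of the attractor. -/
theorem le_mul_packNum [Fintype ι] (hr : ∀ j, r j ∈ Set.Ioo (0 : ℝ) 1)
    (hsim : ∀ j, IsSimilarity (φ j) (r j)) {F : Set X} (hFne : F.Nonempty) (hFc : IsCompact F)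
    (hF : F = ⋃ j, φ j '' F) {D : ℝ} (hD0 : 0 ≤ D) (hD : ∑ j, r j ^ D = 1) {a : X} {Δ : ℝ}
    (hΔ : ∀ y ∈ F, dist a y ≤ Δ) {γ : ℕ}
    (hγ : ∀ s, 0 < s → ∀ (p : X) (T : Finset (List ι)),
      (∀ l ∈ T, l ∈ cutSet r s ∧ dist (wordMap φ l a) p ≤ (2 * Δ + 1) * s) → T.card ≤ γ)
    {s : ℝ} (hs : 0 < s) : s ^ (-D) ≤ γ * packNum F s := by
  classical
  obtain ⟨b, hb⟩ := hFne
  have hΔ0 : 0 ≤ Δ := dist_nonneg.trans (hΔ b hb)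
  obtain ⟨T, hT, hTcard⟩ := exists_finset_cutSet hr hD0 hD hs
  obtain ⟨Q, hQcard, hQ⟩ := exists_cover_card_eq_packNum hFc.totallyBounded hs
  have hsub : ∀ l, wordMap φ l '' F ⊆ F := wordMap_image_subset fun j => by
    conv_rhs => rw [hF]
    exact Set.subset_iUnion (fun j => φ j '' F) j
  choose f hfQ hf using fun l => hQ (wordMap φ l b) (hsub l ⟨b, hb, rfl⟩)
  refine hTcard.trans ?_
  rw [← hQcard]
  refine mod_cast Finset.card_le_mul_card_image_of_maps_to (f := f) (fun l _ => hfQ l) γ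
    fun q _ => hγ s hs q _ fun l hl => ?_
  obtain ⟨hlT, rfl⟩ := Finset.mem_filter.1 hl
  refine ⟨hT hlT, (dist_triangle _ (wordMap φ l b) _).trans ?_⟩
  have h1 : dist (wordMap φ l a) (wordMap φ l b) ≤ s * Δ := by
    rw [dist_wordMap hsim]
    exact mul_le_mul (hT hlT).1 (hΔ b hb) dist_nonneg hs.le
  nlinarith [hf l]

end Metric

section Euclidean

variable {E : Type*} [NormedAddCommGroup E] [InnerProductSpace ℝ E] [FiniteDimensional ℝ E]

theorem IsSimilarity.surjective {f : E → E} {ρ : ℝ} (hf : IsSimilarity f ρ) (hρ : 0 < ρ) :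
    Function.Surjective f := by
  have hiso : Isometry fun x => ρ⁻¹ • f x := Isometry.of_dist_eq fun x y => by
    rw [dist_smul₀, hf x y, Real.norm_of_nonneg (inv_nonneg.2 hρ.le), inv_mul_cancel_left₀ hρ.ne']
  set L := hiso.affineIsometryOfStrictConvexSpace
  have hL : Function.Surjective L := by
    rw [← AffineIsometry.coe_toAffineMap, ← AffineMap.linear_surjective_iff]
    exact LinearMap.injective_iff_surjective.1 L.linearIsometry.injective
  intro y
  obtain ⟨x, hx⟩ := hL (ρ⁻¹ • y)
  exact ⟨x, smul_right_injective E (inv_ne_zero hρ.ne') hx⟩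

/-- Under the open set condition, only boundedly many words of a cut set at scale `s` move the
point `a` of the open set to within distance `R * s` of a given point. -/
theorem exists_card_cutSet_le {ι : Type*} [Finite ι] [Nonempty ι] {φ : ι → E → E} {r : ι → ℝ}
    (hr : ∀ j, r j ∈ Set.Ioo (0 : ℝ) 1) (hsim : ∀ j, IsSimilarity (φ j) (r j)) {V : Set E}
    (hV : ∀ j, φ j '' V ⊆ V) (hdisj : Pairwise fun i j => Disjoint (φ i '' V) (φ j '' V))
    {a : E} (ha : V ∈ 𝓝 a) (R : ℝ) :
    ∃ γ : ℕ, ∀ s, 0 < s → ∀ (p : E) (T : Finset (List ι)),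
      (∀ l ∈ T, l ∈ cutSet r s ∧ dist (wordMap φ l a) p ≤ R * s) → T.card ≤ γ := by
  classical
  obtain ⟨ρ, hρ, haV⟩ := Metric.mem_nhds_iff.1 ha
  obtain ⟨jmin, hjmin⟩ := Finite.exists_min r
  set c := r jmin
  have hc : 0 < c := (hr jmin).1
  obtain ⟨γ, hγ⟩ := exists_card_le_of_totallyBounded
    (isCompact_closedBall (0 : E) R).totallyBounded (s := c * ρ / 2) (by positivity)
  refine ⟨γ, fun s hs p T hT => ?_⟩
  set g : List ι → E := fun l => s⁻¹ • (wordMap φ l a - p)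
  have hs' := inv_pos.2 hs
  have hg : ∀ l ∈ T, ∀ l' ∈ T, l ≠ l' → c * ρ / 2 < dist (g l) (g l') := by
    intro l hl l' hl' hne
    have h := le_dist_of_mem_cutSet hr hsim (fun j => (hsim j).surjective (hr j).1) hV hdisj hρ haV
      hc hjmin hs (hT l hl).1 (hT l' hl').1 hne
    rw [dist_smul₀, dist_sub_right, Real.norm_of_nonneg hs'.le]
    calc c * ρ / 2 < c * ρ := half_lt_self (by positivity)
      _ = s⁻¹ * (c * s * ρ) := by field_simp
      _ ≤ _ := mul_le_mul_of_nonneg_left h hs'.le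
  have hinj : Set.InjOn g T := by
    intro l hl l' hl' h
    by_contra hne
    have := hg l hl l' hl' hne
    rw [h, dist_self] at this
    have : 0 < c * ρ := by positivity
    linarith
  rw [← Finset.card_image_of_injOn hinj]
  refine hγ _ ?_ ?_
  · intro x hx
    obtain ⟨l, hl, rfl⟩ := Finset.mem_image.1 hx
    have h := (hT l hl).2
    rw [mem_closedBall_zero_iff, norm_smul, Real.norm_of_nonneg hs'.le, ← dist_eq_norm,
      inv_mul_le_iff₀ hs, mul_comm]
    exact h
  · rw [Finset.coe_image, hinj.pairwise_image]
    exact fun l hl l' hl' hne => hg l hl l' hl' hne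

theorem boxCount_eq_packNum {m : ℕ} (A : Set (EuclideanSpace ℝ (Fin m))) {x : ℝ} (hx : 0 < x) :
    boxCount A x = packNum A (2 / x) := by
  have hx' : 0 ≤ x⁻¹ := (inv_pos.2 hx).le
  have h2 : x⁻¹ + x⁻¹ = 2 / x := by ring
  unfold boxCount packNum
  simp only [disjoint_closedBall_closedBall_iff hx' hx', h2]
  congr 1
  ext n
  constructor
  · rintro ⟨c, hc, hsep⟩
    have hinj : Function.Injective c := by
      intro i j hij
      by_contra hne
      have : 2 / x < dist (c i) (c j) := hsep hne
      rw [hij, dist_self] at this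
      exact this.not_gt (by positivity)
    refine ⟨Finset.univ.map ⟨c, hinj⟩, ?_, ?_, by simp⟩
    · rintro _ hx
      obtain ⟨i, -, rfl⟩ := Finset.mem_map.1 hx
      exact hc i
    · intro y hy z hz hyz
      obtain ⟨i, -, rfl⟩ := Finset.mem_map.1 hy
      obtain ⟨j, -, rfl⟩ := Finset.mem_map.1 hz
      exact hsep fun h => hyz (h ▸ rfl)
  · rintro ⟨T, hT, hsep, rfl⟩
    refine ⟨fun i => (T.equivFin.symm i : EuclideanSpace ℝ (Fin m)), fun i => hT (Subtype.mem _),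
      fun i j hij => hsep (Subtype.mem _) (Subtype.mem _) ?_⟩
    exact fun h => hij (T.equivFin.symm.injective (Subtype.ext h))

end Euclidean

/-- Convergence of the normalized packing numbers of a nonlattice self-similar set, given that
the overlaps of its first-level pieces have a smaller growth exponent. -/
theorem exists_tendsto_packNum {ι X : Type*} [Fintype ι] [Nonempty ι] [MetricSpace X]
    {φ : ι → X → X} {r : ι → ℝ} (hr : ∀ j, r j ∈ Set.Ioo (0 : ℝ) 1)
    (hsim : ∀ j, IsSimilarity (φ j) (r j)) {F : Set X} (hFc : IsCompact F)
    (hF : F = ⋃ j, φ j '' F) {D : ℝ} (hD0 : 0 < D) (hD : ∑ j, r j ^ D = 1)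
    (hdense : Dense ((AddSubgroup.closure (Set.range fun j => Real.log (r j)) :
      AddSubgroup ℝ) : Set ℝ))
    {D' K s₀ : ℝ} (hD' : D' < D) (hK : 0 ≤ K) (hs₀ : 0 < s₀)
    (hover : ∀ b s, 0 < s → s ≤ s₀ →
      (packNum (φ b '' F ∩ {y | ∃ j, j ≠ b ∧ ∃ z ∈ φ j '' F, dist y z ≤ s}) s : ℝ)
        ≤ K * s ^ (-D')) :
    ∃ M, Tendsto (fun t : ℝ => Real.exp (-D * t) * packNum F (Real.exp (-t))) atTop (𝓝 M) := by
  have htb := hFc.totallyBounded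
  have hsub : ∀ j, φ j '' F ⊆ F := fun j => by
    conv_rhs => rw [hF]
    exact Set.subset_iUnion (fun j => φ j '' F) j
  have hp : ∀ j, 0 < r j ^ D := fun j => Real.rpow_pos_of_pos (hr j).1 D
  have hscale : ∀ t j, r j ^ D * (Real.exp (-D * (t - -Real.log (r j))) *
      packNum F (Real.exp (-(t - -Real.log (r j))))) =
        Real.exp (-D * t) * packNum (φ j '' F) (Real.exp (-t)) := by
    intro t j
    have h1 : Real.exp (-(t - -Real.log (r j))) = Real.exp (-t) / r j := by
      rw [show -(t - -Real.log (r j)) = -t - Real.log (r j) by ring, Real.exp_sub,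
        Real.exp_log (hr j).1]
    rw [h1, packNum_image (hr j).1 (hsim j), ← mul_assoc, Real.rpow_def_of_pos (hr j).1,
      ← Real.exp_add]
    congr 2
    ring
  refine exists_tendsto_of_renewal (p := fun j => r j ^ D) (d := fun j => -Real.log (r j))
    (δ := D - D') (K := Fintype.card ι * K) (t₀ := -Real.log s₀) hp hD
    (fun j => neg_pos.2 (Real.log_neg (hr j).1 (hr j).2)) ?_ hD0.le (by linarith) (by positivity)
    (fun t => by positivity) ?_ ?_ ?_
  · have : (Set.range fun j => -Real.log (r j)) = -Set.range fun j => Real.log (r j) := by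
      ext x
      simp [neg_eq_iff_eq_neg]
    rwa [this, AddSubgroup.closure_neg]
  · intro t h hh
    rw [← mul_assoc, ← Real.exp_add, show -D * h + -D * t = -D * (t + h) by ring]
    refine mul_le_mul_of_nonneg_left ?_ (Real.exp_pos _).le
    exact_mod_cast packNum_mono htb subset_rfl (Real.exp_pos _)
      (Real.exp_le_exp.2 (by linarith : -(t + h) ≤ -t))
  · intro t
    simp only [hscale]
    rw [← Finset.mul_sum]
    refine mul_le_mul_of_nonneg_left ?_ (Real.exp_pos _).le
    refine mod_cast packNum_le_sum Finset.univ (fun j => φ j '' F)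
      (fun j _ => htb.subset (hsub j)) (fun x hx => ?_) (Real.exp_pos _)
    rw [hF] at hx
    simpa using hx
  · intro t ht
    simp only [hscale]
    rw [← Finset.mul_sum]
    set s := Real.exp (-t) with hs
    have hs0 : 0 < s := Real.exp_pos _
    have hss : s ≤ s₀ := by
      rw [hs, ← Real.le_log_iff_exp_le hs₀]
      linarith
    have h1 : (∑ j, packNum (φ j '' F) s : ℝ) ≤ packNum F s + Fintype.card ι * K * s ^ (-D') := by
      calc (∑ j, packNum (φ j '' F) s : ℝ) ≤ packNum F s +
            ∑ b, (packNum (φ b '' F ∩ {y | ∃ j, j ≠ b ∧ ∃ z ∈ φ j '' F, dist y z ≤ s}) s : ℝ) := by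
            exact_mod_cast sum_packNum_le htb (fun j => φ j '' F) hsub hs0
        _ ≤ packNum F s + ∑ _b : ι, K * s ^ (-D') := by
            gcongr with b
            exact hover b s hs0 hss
        _ = _ := by simp [mul_assoc]
    have h2 : Real.exp (-(D - D') * t) = Real.exp (-D * t) * s ^ (-D') := by
      rw [hs, ← Real.exp_mul, ← Real.exp_add]
      congr 1
      ring
    rw [h2]
    have := mul_le_mul_of_nonneg_left h1 (Real.exp_pos (-D * t)).le
    linarith

/-- Nonlattice case of Lalley's dichotomy: for a self-similar system on `ℝ^m` satisfying the
open set condition, with attractor `F` and similarity dimension `D`, if the additive group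
generated by the `log r_j` is dense in `ℝ`, then `N_B(F,x)/x^D` tends to a positive constant
as `x → ∞`. -/
theorem stmt10 {m N : ℕ} (hN : 2 ≤ N)
    (φ : Fin N → EuclideanSpace ℝ (Fin m) → EuclideanSpace ℝ (Fin m))
    (r : Fin N → ℝ) (hr : ∀ j, r j ∈ Set.Ioo (0 : ℝ) 1)
    (hsim : ∀ j, IsSimilarity (φ j) (r j))
    (hOSC : ∃ V : Set (EuclideanSpace ℝ (Fin m)), V.Nonempty ∧ IsOpen V ∧
      (∀ j, φ j '' V ⊆ V) ∧ Pairwise fun i j => Disjoint (φ i '' V) (φ j '' V))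
    (F : Set (EuclideanSpace ℝ (Fin m)))
    (hFne : F.Nonempty) (hFc : IsCompact F) (hFinv : F = ⋃ j, φ j '' F)
    (D : ℝ) (hD : ∑ j, r j ^ D = 1)
    (hdense : Dense ((AddSubgroup.closure (Set.range fun j => Real.log (r j)) :
      AddSubgroup ℝ) : Set ℝ)) :
    ∃ C : ℝ, 0 < C ∧
      Tendsto (fun x : ℝ => (boxCount F x : ℝ) / x ^ D) atTop (𝓝 C) := by
  have : Nonempty (Fin N) := ⟨⟨0, by omega⟩⟩
  obtain ⟨V, ⟨a, ha⟩, hVo, hV, hdisj⟩ := hOSC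
  have hD0 : 0 < D := by
    by_contra! hneg
    have h1 : ∑ _j : Fin N, (1 : ℝ) ≤ ∑ j, r j ^ D := Finset.sum_le_sum fun j _ =>
      Real.one_le_rpow_of_pos_of_le_one_of_nonpos (hr j).1 (hr j).2.le hneg
    have h2 : (2 : ℝ) ≤ N := by exact_mod_cast hN
    simp only [Finset.sum_const, Finset.card_univ, Fintype.card_fin, nsmul_eq_mul, mul_one, hD] at h1
    linarith
  obtain ⟨Δ, hΔ⟩ : ∃ Δ, ∀ y ∈ F, dist a y ≤ Δ := by
    obtain ⟨Δ, hΔ⟩ := hFc.isBounded.subset_closedBall a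
    exact ⟨Δ, fun y hy => by rw [dist_comm]; exact hΔ hy⟩
  obtain ⟨γ, hγ⟩ := exists_card_cutSet_le hr hsim hV hdisj (hVo.mem_nhds ha) (2 * Δ + 1)
  obtain ⟨k, hk⟩ := exists_isolated_word hr hsim hFinv hΔ hγ
  obtain ⟨D', hD', K, s₀, hK, hs₀, hover⟩ := packNum_overlap_le hr hsim hFc hFinv hD0 hD hk
  obtain ⟨M, hM⟩ := exists_tendsto_packNum hr hsim hFc hFinv hD0 hD hdense hD' hK hs₀ hover
  have hγM : 1 ≤ γ * M := by
    refine ge_of_tendsto' (hM.const_mul (γ : ℝ)) fun t => ?_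
    have h := le_mul_packNum hr hsim hFne hFc hFinv hD0.le hD hΔ hγ (Real.exp_pos (-t))
    rw [← Real.exp_mul] at h
    calc (1 : ℝ) = Real.exp (-D * t) * Real.exp (-t * -D) := by
          rw [← Real.exp_add, ← Real.exp_zero]
          congr 1
          ring
      _ ≤ Real.exp (-D * t) * (γ * packNum F (Real.exp (-t))) := by gcongr
      _ = _ := by ring
  have hM0 : 0 < M := by
    by_contra! h
    nlinarith [(Nat.cast_nonneg γ : (0 : ℝ) ≤ γ)]
  have hlog : Tendsto (fun x : ℝ => Real.log (x / 2)) atTop atTop :=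
    Real.tendsto_log_atTop.comp (tendsto_id.atTop_div_const two_pos)
  refine ⟨2 ^ (-D) * M, by positivity, ((hM.comp hlog).const_mul (2 ^ (-D) : ℝ)).congr' ?_⟩
  filter_upwards [eventually_gt_atTop 0] with x hx
  have hx2 : 0 < x / 2 := by positivity
  rw [Function.comp_apply, boxCount_eq_packNum F hx, Real.exp_neg, Real.exp_log hx2, inv_div,
    mul_comm (-D), ← Real.rpow_def_of_pos hx2, ← mul_assoc, ← Real.mul_rpow two_pos.le hx2.le,
    mul_div_cancel₀ x two_ne_zero, Real.rpow_neg hx.le]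
  ring
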